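/- arXiv:1104.5571 — 2 statements merged into one kernel-verified Lean document; each statement's English description precedes it below -/
import Mathlib

section
/- Let n ≥ 1 be an integer and ω = e^{2πi/n}. Let 𝒴 be a finite collection of subsets of {0,1,…,n−1}, and for each Y ∈ 𝒴 let Z_Y be a nonzero polynomial with complex coefficients. For a subset Y write s_Y = Σ_{y∈Y} ω^y and Y⁺ = {y+1 mod n : y ∈ Y}, and assume the map W ↦ s_W is injective on 𝒴 ∪ {Y⁺ : Y ∈ 𝒴}. Define f(ρ) = Σ_{Y∈𝒴} Z_Y(ρ) e^{−iρ s_Y} and suppose f(ρ) = (−1)^{n−1} f(ωρ) for all ρ ∈ ℂ. Then for every Y ∈ 𝒴 one has Y⁺ ∈ 𝒴 and Z_{Y⁺}(ρ) = (−1)^{n−1} Z_Y(ωρ) for all ρ ∈ ℂ. -/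
noncomputable section
open Complex Finset

namespace IBVP

/-- ω = exp(2πi/n). -/
def ww (n : ℕ) : ℂ := Complex.exp (2 * Real.pi * I / n)

open Polynomial in
/-- `f' + c f = 0` with `c ≠ 0` has no nonzero polynomial solution. -/
theorem eq_zero_of_derivative_add_C_mul_eq_zero {c : ℂ} (hc : c ≠ 0) {p : ℂ[X]}
    (h : derivative p + C c * p = 0) : p = 0 := by
  by_contra hp
  have hd : (derivative p).degree < (C c * p).degree := by
    rw [degree_C_mul hc]
    exact degree_derivative_lt hp
  have hs := degree_add_eq_right_of_degree_lt hd
  rw [h, degree_zero, degree_C_mul hc] at hs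
  exact hp (degree_eq_bot.mp hs.symm)

open Polynomial in
/-- Differentiating a vanishing exponential polynomial and subtracting `a` times it. -/
theorem sum_derivative_add_mul_exp_eq_zero {ι : Type*} (S : Finset ι) (s : ι → ℂ) (P : ι → ℂ[X])
    (a : ℂ) (h : ∀ z : ℂ, ∑ i ∈ S, (P i).eval z * Complex.exp (s i * z) = 0) (z : ℂ) :
    ∑ i ∈ S, (derivative (P i) + C (s i - a) * P i).eval z * Complex.exp (s i * z) = 0 := by
  have hderiv : HasDerivAt (fun z : ℂ => ∑ i ∈ S, (P i).eval z * Complex.exp (s i * z))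
      (∑ i ∈ S, ((derivative (P i)).eval z * Complex.exp (s i * z) +
        (P i).eval z * (Complex.exp (s i * z) * (s i * 1)))) z :=
    HasDerivAt.fun_sum fun i _ =>
      ((P i).hasDerivAt z).mul ((hasDerivAt_id z).const_mul (s i)).cexp
  rw [funext h] at hderiv
  have h0 := hderiv.unique (hasDerivAt_const z (0 : ℂ))
  calc _ = ∑ i ∈ S, ((derivative (P i)).eval z * Complex.exp (s i * z) +
        (P i).eval z * (Complex.exp (s i * z) * (s i * 1))) -
        a * ∑ i ∈ S, (P i).eval z * Complex.exp (s i * z) := by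
        rw [Finset.mul_sum, ← Finset.sum_sub_distrib]
        refine Finset.sum_congr rfl fun i _ => ?_
        simp only [eval_add, eval_mul, eval_C]
        ring
    _ = 0 := by rw [h0, h z, mul_zero, sub_zero]

open Polynomial in
/-- Exponentials with distinct frequencies are linearly independent over the polynomials. -/
theorem coeff_eq_zero_of_sum_mul_exp_eq_zero {ι : Type*} (S : Finset ι) (s : ι → ℂ)
    (hs : Set.InjOn s S) (P : ι → ℂ[X])
    (h : ∀ z : ℂ, ∑ i ∈ S, (P i).eval z * Complex.exp (s i * z) = 0) : ∀ i ∈ S, P i = 0 := by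
  classical
  induction S using Finset.induction_on generalizing P with
  | empty => simp
  | insert a S ha ih =>
    have hS : Set.InjOn s S := hs.mono (by simp)
    have hrest : ∀ (k : ℕ) (Q : ι → ℂ[X]), derivative^[k] (Q a) = 0 →
        (∀ z : ℂ, ∑ i ∈ insert a S, (Q i).eval z * Complex.exp (s i * z) = 0) →
        ∀ i ∈ S, Q i = 0 := by
      intro k
      induction k with
      | zero =>
        intro Q hQ hsum
        rw [Function.iterate_zero_apply] at hQ
        refine ih hS Q fun z => ?_
        simpa [Finset.sum_insert ha, hQ] using hsum z
      | succ k ihk =>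
        intro Q hQ hsum i hi
        have hne : s i - s a ≠ 0 := fun h0 => ha <| by
          have := hs (by simp [hi]) (by simp) (sub_eq_zero.mp h0)
          rwa [← this]
        exact eq_zero_of_derivative_add_C_mul_eq_zero hne <|
          ihk (fun i => derivative (Q i) + C (s i - s a) * Q i) (by simpa using hQ)
            (sum_derivative_add_mul_exp_eq_zero _ s Q (s a) hsum) i hi
    have hzero := hrest _ P (iterate_derivative_eq_zero (Nat.lt_succ_self (P a).natDegree)) h
    have hPa : P a = 0 := by
      refine Polynomial.funext fun z => ?_
      have hz := h z
      rw [Finset.sum_insert ha, Finset.sum_eq_zero fun i hi => by rw [hzero i hi]; simp] at hz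
      simpa [Complex.exp_ne_zero] using hz
    intro i hi
    rcases Finset.mem_insert.mp hi with rfl | hi
    · exact hPa
    · exact hzero i hi

theorem ww_pow_self {n : ℕ} (hn : 1 ≤ n) : ww n ^ n = 1 :=
  (Complex.isPrimitiveRoot_exp n (by omega)).pow_eq_one

theorem ww_ne_zero (n : ℕ) : ww n ≠ 0 := Complex.exp_ne_zero _

theorem succ_mod_injective {n : ℕ} (hn : 1 ≤ n) :
    Function.Injective (fun y : Fin n => (⟨((y : ℕ) + 1) % n, Nat.mod_lt _ hn⟩ : Fin n)) := by
  intro x y hxy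
  have h : (x : ℕ) + 1 ≡ y + 1 [MOD n] := congrArg Fin.val hxy
  exact Fin.ext ((Nat.ModEq.add_right_cancel' 1 h).eq_of_lt_of_lt x.2 y.2)

theorem sum_ww_pow_image_succ_mod {n : ℕ} (hn : 1 ≤ n) (Y : Finset (Fin n)) :
    ∑ y ∈ Y.image (fun y : Fin n => (⟨((y : ℕ) + 1) % n, Nat.mod_lt _ hn⟩ : Fin n)),
      ww n ^ (y : ℕ) = ww n * ∑ y ∈ Y, ww n ^ (y : ℕ) := by
  rw [Finset.sum_image (succ_mod_injective hn).injOn, Finset.mul_sum]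
  refine Finset.sum_congr rfl fun y _ => ?_
  rw [← pow_eq_pow_mod _ (ww_pow_self hn), pow_succ']

open Polynomial in
/-- If `Σ_Y Z_Y e^{s_Y z} = Σ_Y Z'_Y e^{s_{σ Y} z}` with `σ` injective, the frequencies distinct and
the `Z'_Y` nonzero, then `σ` maps the index set to itself and `Z_{σ Y} = Z'_Y`. -/
theorem coeff_eq_of_sum_mul_exp_eq {ι : Type*} [DecidableEq ι] (S : Finset ι) (σ : ι → ι)
    (hσ : Function.Injective σ) (s : ι → ℂ) (hs : Set.InjOn s ↑(S ∪ S.image σ))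
    (Z Z' : ι → ℂ[X]) (hZ' : ∀ i ∈ S, Z' i ≠ 0)
    (h : ∀ z : ℂ, ∑ i ∈ S, (Z i).eval z * Complex.exp (s i * z) =
      ∑ i ∈ S, (Z' i).eval z * Complex.exp (s (σ i) * z)) :
    ∀ i ∈ S, σ i ∈ S ∧ Z (σ i) = Z' i := by
  have hP := coeff_eq_zero_of_sum_mul_exp_eq_zero (S ∪ S.image σ) s hs
    (fun j => (if j ∈ S then Z j else 0) - ∑ i ∈ S with σ i = j, Z' i) fun z => by
      have h₁ : ∑ j ∈ S ∪ S.image σ,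
          (if j ∈ S then Z j else 0).eval z * Complex.exp (s j * z) =
          ∑ i ∈ S, (Z i).eval z * Complex.exp (s i * z) := by
        rw [← Finset.sum_subset Finset.subset_union_left]
        · exact Finset.sum_congr rfl fun i hi => by rw [if_pos hi]
        · intro i _ hi
          simp [hi]
      have h₂ : ∑ j ∈ S ∪ S.image σ,
          (∑ i ∈ S with σ i = j, Z' i).eval z * Complex.exp (s j * z) =
          ∑ i ∈ S, (Z' i).eval z * Complex.exp (s (σ i) * z) := by
        rw [← Finset.sum_fiberwise_of_maps_to (t := S ∪ S.image σ) (g := σ) fun i hi =>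
          Finset.mem_union_right _ (Finset.mem_image_of_mem σ hi)]
        refine Finset.sum_congr rfl fun j _ => ?_
        rw [eval_finsetSum, Finset.sum_mul]
        exact Finset.sum_congr rfl fun i hi => by rw [(Finset.mem_filter.mp hi).2]
      simp only [eval_sub, sub_mul, Finset.sum_sub_distrib]
      rw [h₁, h₂, h z, sub_self]
  intro i hi
  have hfiber : (∑ k ∈ S with σ k = σ i, Z' k) = Z' i := by
    have : S.filter (fun k => σ k = σ i) = {i} := by
      ext k
      simp only [Finset.mem_filter, Finset.mem_singleton, hσ.eq_iff]
      exact ⟨fun hk => hk.2, fun hk => ⟨hk ▸ hi, hk⟩⟩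
    rw [this, Finset.sum_singleton]
  have hi' := hP (σ i) (Finset.mem_union_right _ (Finset.mem_image_of_mem σ hi))
  simp only [hfiber] at hi'
  by_cases hmem : σ i ∈ S
  · rw [if_pos hmem] at hi'
    exact ⟨hmem, sub_eq_zero.mp hi'⟩
  · rw [if_neg hmem, zero_sub, neg_eq_zero] at hi'
    exact absurd hi' (hZ' i hi)

/-- Lemma 5.1(ii): let `f(ρ) = Σ_{Y∈𝒴} Z_Y(ρ) e^{-iρ s_Y}` with `s_Y = Σ_{y∈Y} ω^y` and
nonzero polynomial coefficients `Z_Y`, where `W ↦ s_W` is injective on `𝒴 ∪ {Y⁺ : Y ∈ 𝒴}`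
(`Y⁺` being `Y` shifted by `+1 mod n`).  If `f(ρ) = (-1)^{n-1} f(ωρ)` for all ρ, then for
every `Y ∈ 𝒴` one has `Y⁺ ∈ 𝒴` and `Z_{Y⁺}(ρ) = (-1)^{n-1} Z_Y(ωρ)`. -/
theorem exp_poly_coefficient_symmetry (n : ℕ) (hn : 1 ≤ n)
    (𝒴 : Finset (Finset (Fin n))) (Z : Finset (Fin n) → Polynomial ℂ)
    (hZ : ∀ Y ∈ 𝒴, Z Y ≠ 0)
    (hinj : Set.InjOn (fun Y : Finset (Fin n) => ∑ y ∈ Y, (ww n) ^ (y : ℕ))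
      ↑(𝒴 ∪ 𝒴.image (fun Y =>
        Y.image (fun y : Fin n => (⟨((y : ℕ) + 1) % n, Nat.mod_lt _ hn⟩ : Fin n)))))
    (hsym : ∀ ρ : ℂ,
      (∑ Y ∈ 𝒴, (Z Y).eval ρ *
          Complex.exp (-(I * ρ * ∑ y ∈ Y, (ww n) ^ (y : ℕ)))) =
        (-1 : ℂ) ^ (n - 1) *
          ∑ Y ∈ 𝒴, (Z Y).eval (ww n * ρ) *
            Complex.exp (-(I * (ww n * ρ) * ∑ y ∈ Y, (ww n) ^ (y : ℕ)))) :
    ∀ Y ∈ 𝒴,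
      (Y.image (fun y : Fin n => (⟨((y : ℕ) + 1) % n, Nat.mod_lt _ hn⟩ : Fin n))) ∈ 𝒴 ∧
      ∀ ρ : ℂ,
        (Z (Y.image (fun y : Fin n =>
            (⟨((y : ℕ) + 1) % n, Nat.mod_lt _ hn⟩ : Fin n)))).eval ρ =
          (-1 : ℂ) ^ (n - 1) * (Z Y).eval (ww n * ρ) := by
  have hscale : (Polynomial.C (ww n) * Polynomial.X).natDegree ≠ 0 := by
    rw [Polynomial.natDegree_C_mul_X _ (ww_ne_zero n)]
    exact one_ne_zero
  have hc : ((-1 : ℂ) ^ (n - 1)) ≠ 0 := by simp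
  have key := coeff_eq_of_sum_mul_exp_eq 𝒴
    (fun Y => Y.image (fun y : Fin n => (⟨((y : ℕ) + 1) % n, Nat.mod_lt _ hn⟩ : Fin n)))
    (Finset.image_injective (succ_mod_injective hn))
    (fun Y => -I * ∑ y ∈ Y, ww n ^ (y : ℕ))
    (fun Y hY W hW h => hinj hY hW (mul_left_cancel₀ (neg_ne_zero.mpr I_ne_zero) h)) Z
    (fun Y => Polynomial.C ((-1 : ℂ) ^ (n - 1)) * (Z Y).comp (Polynomial.C (ww n) * Polynomial.X))
    (fun Y hY => mul_ne_zero (Polynomial.C_ne_zero.mpr hc) fun h0 => hZ Y hY <| by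
      rcases Polynomial.comp_eq_zero_iff.mp h0 with h0 | ⟨_, h0⟩
      · exact h0
      · exact absurd (h0 ▸ Polynomial.natDegree_C _) hscale)
    fun z => by
      convert hsym z using 1
      · refine Finset.sum_congr rfl fun Y _ => ?_
        ring_nf
      · rw [Finset.mul_sum]
        refine Finset.sum_congr rfl fun Y _ => ?_
        simp only [Polynomial.eval_mul, Polynomial.eval_C,
          Polynomial.eval_comp, Polynomial.eval_X]
        rw [sum_ww_pow_image_succ_mod hn Y]
        ring_nf
  intro Y hY
  obtain ⟨hmem, heq⟩ := key Y hY
  exact ⟨hmem, fun ρ => by simp [heq]⟩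

end IBVP
end
end

section
/- Let n ≥ 2 be an integer, ω = e^{2πi/n}, and a = ±i. Set m = n/2 if n is even, m = (n+1)/2 if n is odd and a = i, and m = (n−1)/2 if n is odd and a = −i. Let ρ = r e^{iφ} with r > 0 and with φ ∈ (0, π/n) if a = i, φ ∈ (π/n, 2π/n) if a = −i (so that ρ lies in the first connected component, encountered anticlockwise from the positive real axis, of the domain D = {ρ ∈ ℂ : Re(aρ^n) < 0}). Then for every subset Y ⊆ {0,1,…,n−1} with Y ≠ {0,1,…,m−1}, one has Im(ρ·Σ_{y∈Y} ω^y) < Im(ρ·Σ_{y=0}^{m−1} ω^y); equivalently, the function Y ↦ |exp(−iρ·Σ_{y∈Y} ω^y)| on subsets of {0,1,…,n−1} is uniquely maximised at Y = {0,1,…,m−1}. -/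
noncomputable section
open Complex Finset

namespace IBVP

/-- If `f` is positive on `s` and negative off `s`, then `s` is the unique finset maximising
the sum of `f`. -/
theorem sum_lt_sum_of_pos_of_neg {ι : Type*} [DecidableEq ι] {f : ι → ℝ} {s t : Finset ι}
    (hpos : ∀ i ∈ s, 0 < f i) (hneg : ∀ i ∉ s, f i < 0) (hts : t ≠ s) :
    ∑ i ∈ t, f i < ∑ i ∈ s, f i := by
  have hs := Finset.sum_inter_add_sum_sdiff s t f
  have ht := Finset.sum_inter_add_sum_sdiff t s f
  rw [Finset.inter_comm] at ht
  have hst_nonneg : 0 ≤ ∑ i ∈ s \ t, f i :=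
    Finset.sum_nonneg fun i hi => (hpos i (Finset.mem_sdiff.mp hi).1).le
  rcases (t \ s).eq_empty_or_nonempty with h | h
  · have hne : (s \ t).Nonempty := by
      rw [Finset.sdiff_nonempty]
      exact fun hst => hts (Finset.Subset.antisymm (Finset.sdiff_eq_empty_iff_subset.mp h) hst)
    have := Finset.sum_pos (fun i hi => hpos i (Finset.mem_sdiff.mp hi).1) hne
    rw [h, Finset.sum_empty] at ht
    linarith
  · have := Finset.sum_neg (fun i hi => hneg i (Finset.mem_sdiff.mp hi).2) h
    linarith

theorem im_mul_ww_pow (n y : ℕ) (r φ : ℝ) :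
    ((r : ℂ) * Complex.exp (φ * I) * ww n ^ y).im = r * Real.sin (φ + 2 * Real.pi * y / n) := by
  have h : Complex.exp (φ * I) * ww n ^ y
      = Complex.exp (((φ + 2 * Real.pi * y / n : ℝ) : ℂ) * I) := by
    rw [ww, ← Complex.exp_nat_mul, ← Complex.exp_add]
    congr 1
    push_cast
    ring
  rw [mul_assoc, h, Complex.im_ofReal_mul, Complex.exp_ofReal_mul_I_im]

/-- For `a = ±i` and `ρ = r e^{iφ}` in the first connected component of
`D = {Re(aρⁿ) < 0}` (anticlockwise from the positive real axis), the quantity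
`Im(ρ Σ_{y∈Y} ω^y)`, over subsets `Y ⊆ {0,…,n-1}`, is uniquely maximised at
`Y = {0,1,…,m-1}` where `m = n/2` (n even), `m = (n+1)/2` (n odd, a = i),
`m = (n-1)/2` (n odd, a = -i); equivalently `|e^{-iρ Σ_{y∈Y} ω^y}|` is uniquely
maximised there. -/
theorem exponential_uniquely_maximised (n : ℕ) (hn : 2 ≤ n) (a : ℂ)
    (ha : a = I ∨ a = -I) (m : ℕ)
    (hmEven : Even n → m = n / 2)
    (hmOddI : Odd n → a = I → m = (n + 1) / 2)
    (hmOddNegI : Odd n → a = -I → m = (n - 1) / 2)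
    (r φ : ℝ) (hr : 0 < r)
    (hφI : a = I → φ ∈ Set.Ioo 0 (Real.pi / n))
    (hφnegI : a = -I → φ ∈ Set.Ioo (Real.pi / n) (2 * Real.pi / n))
    (ρ : ℂ) (hρ : ρ = (r : ℂ) * Complex.exp (φ * I)) :
    ∀ Y : Finset (Fin n), Y ≠ (Finset.univ : Finset (Fin n)).filter (fun y : Fin n => (y : ℕ) < m) →
      (ρ * ∑ y ∈ Y, (ww n) ^ (y : ℕ)).im <
        (ρ * ∑ y ∈ (Finset.univ : Finset (Fin n)).filter (fun y : Fin n => (y : ℕ) < m), (ww n) ^ (y : ℕ)).im := by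
  have hn0 : (0 : ℝ) < n := by exact_mod_cast (by omega : 0 < n)
  have hpi := Real.pi_pos
  have hφ : 0 < φ ∧ φ < 2 * Real.pi / n ∧
      (∀ y : ℕ, y < m → φ + 2 * Real.pi * y / n < Real.pi) ∧
      (∀ y : ℕ, m ≤ y → Real.pi < φ + 2 * Real.pi * y / n) := by
    rcases ha with rfl | rfl
    · obtain ⟨h0, h1⟩ := hφI rfl
      rw [lt_div_iff₀ hn0] at h1
      have hm : ∀ y : ℕ, (y < m → 2 * y + 1 ≤ n) ∧ (m ≤ y → n ≤ 2 * y) := by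
        intro y
        rcases n.even_or_odd with h | h
        · have := hmEven h
          obtain ⟨k, hk⟩ := h
          omega
        · have := hmOddI h rfl
          obtain ⟨k, hk⟩ := h
          omega
      refine ⟨h0, ?_, fun y hy => ?_, fun y hy => ?_⟩
      · rw [lt_div_iff₀ hn0]
        linarith
      · have h : (2 * y + 1 : ℝ) ≤ n := by exact_mod_cast (hm y).1 hy
        rw [← lt_sub_iff_add_lt', div_lt_iff₀ hn0]
        nlinarith
      · have h : (n : ℝ) ≤ 2 * y := by exact_mod_cast (hm y).2 hy
        rw [← sub_lt_iff_lt_add', lt_div_iff₀ hn0]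
        nlinarith [mul_pos h0 hn0]
    · obtain ⟨h0, h1⟩ := hφnegI rfl
      have hφ0 : 0 < φ := lt_trans (by positivity) h0
      have h1' := h1
      rw [lt_div_iff₀ hn0] at h1
      rw [div_lt_iff₀ hn0] at h0
      have hm : ∀ y : ℕ, (y < m → 2 * y + 2 ≤ n) ∧ (m ≤ y → n ≤ 2 * y + 1) := by
        intro y
        rcases n.even_or_odd with h | h
        · have := hmEven h
          obtain ⟨k, hk⟩ := h
          omega
        · have := hmOddNegI h rfl
          obtain ⟨k, hk⟩ := h
          omega
      refine ⟨hφ0, h1', fun y hy => ?_, fun y hy => ?_⟩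
      · have h : (2 * y + 2 : ℝ) ≤ n := by exact_mod_cast (hm y).1 hy
        rw [← lt_sub_iff_add_lt', div_lt_iff₀ hn0]
        nlinarith
      · have h : (n : ℝ) ≤ 2 * y + 1 := by exact_mod_cast (hm y).2 hy
        rw [← sub_lt_iff_lt_add', lt_div_iff₀ hn0]
        nlinarith
  obtain ⟨hφ0, hφ2, hlt, hge⟩ := hφ
  intro Y hY
  simp only [hρ, Finset.mul_sum, Complex.im_sum, im_mul_ww_pow]
  refine sum_lt_sum_of_pos_of_neg (fun y hy => ?_) (fun y hy => ?_) hY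
  · refine mul_pos hr (Real.sin_pos_of_pos_of_lt_pi (by positivity) (hlt y ?_))
    simpa using hy
  · refine mul_neg_of_pos_of_neg hr ?_
    have hpi_lt := hge y (by simpa using hy)
    have hlt_two_pi : φ + 2 * Real.pi * (y : ℕ) / n < 2 * Real.pi := by
      have hyn : ((y : ℕ) : ℝ) + 1 ≤ n := by exact_mod_cast y.isLt
      rw [lt_div_iff₀ hn0] at hφ2
      rw [← lt_sub_iff_add_lt', div_lt_iff₀ hn0]
      nlinarith
    rw [← Real.sin_sub_two_pi]
    exact Real.sin_neg_of_neg_of_neg_pi_lt (by linarith) (by linarith)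

end IBVP
end
end
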